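/- Let N1, N2, N3 be negators, and suppose the cubic graph G = NNN(N1,N2,N3) — formed by arranging the three negators in a circle (joining Oi to I_{i+1} cyclically) and attaching a new vertex to the three residual semiedges — is a bicritical snark. Then each negator Ni = Neg(Gi; ui, vi) is bicritical, i.e., for every two distinct vertices x, y of Ni the multipole Gi − {x,y} is 3-edge-colourable. -/

import Mathlib

/-- The Klein four-group `Z₂ × Z₂`; Tait colourings use its three nonzero
elements as colours. -/
abbrev Klein : Type := ZMod 2 × ZMod 2

/-- A (cubic) multipole: a finite set of vertices and edges, where each edge has
two ends (`fst` and `snd`), each of which is either incident with a vertex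
(`some v`) or free (`none`), the latter being a *semiedge*. -/
structure Multipole where
  V : Type
  E : Type
  [instVF : Fintype V]
  [instEF : Fintype E]
  [instVD : DecidableEq V]
  [instED : DecidableEq E]
  fst : E → Option V
  snd : E → Option V

attribute [instance] Multipole.instVF Multipole.instEF Multipole.instVD Multipole.instED

namespace Multipole

variable (M : Multipole)

/-- The end of edge `e` on side `b`. -/
def endAt (e : M.E) (b : Bool) : Option M.V := if b then M.fst e else M.snd e

/-- The number of edge ends incident with `v`. -/
def degree (v : M.V) : ℕ :=
  (Finset.univ.filter fun p : M.E × Bool => M.endAt p.1 p.2 = some v).card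

/-- Every vertex is incident with exactly three edge ends. -/
def IsCubic : Prop := ∀ v : M.V, M.degree v = 3

/-- No semiedges: every edge end is incident with a vertex (i.e. `M` is a graph). -/
def Closed : Prop := ∀ (e : M.E) (b : Bool), M.endAt e b ≠ none

/-- Edge `e` joins vertices `x` and `y`. -/
def Joins (e : M.E) (x y : M.V) : Prop :=
  (M.fst e = some x ∧ M.snd e = some y) ∨ (M.fst e = some y ∧ M.snd e = some x)

def Adj (x y : M.V) : Prop := ∃ e : M.E, M.Joins e x y

def Conn : Prop := ∀ x y : M.V, Relation.ReflTransGen M.Adj x y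

/-- A proper 3-edge-colouring (Tait colouring): every edge gets a nonzero
element of the Klein group and the edge ends meeting at any vertex get
pairwise distinct colours. -/
def Proper (φ : M.E → Klein) : Prop :=
  (∀ e, φ e ≠ 0) ∧
  ∀ (v : M.V) (p q : M.E × Bool),
    M.endAt p.1 p.2 = some v → M.endAt q.1 q.2 = some v → p ≠ q → φ p.1 ≠ φ q.1

def Colourable : Prop := ∃ φ : M.E → Klein, M.Proper φ

/-- A colouring viewed as a nowhere-zero `Z₂ × Z₂`-flow: nonzero colours whose
sum at each vertex is `0`.  At 3-valent vertices this is equivalent to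
properness; at a 2-valent vertex it forces the two incident edges to receive
equal colours, which is exactly the condition for the colouring to descend to
the cubic graph obtained by suppressing that vertex. -/
def ProperFlow (φ : M.E → Klein) : Prop :=
  (∀ e, φ e ≠ 0) ∧
  ∀ v : M.V, (∑ p : M.E × Bool, if M.endAt p.1 p.2 = some v then φ p.1 else 0) = 0

def FlowColourable : Prop := ∃ φ : M.E → Klein, M.ProperFlow φ

/-- A snark: a connected cubic graph without a proper 3-edge-colouring. -/
def IsSnark : Prop := M.IsCubic ∧ M.Closed ∧ M.Conn ∧ ¬ M.Colourable

/-- The number of semiedges of `M`. -/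
def semiendCount : ℕ :=
  (Finset.univ.filter fun p : M.E × Bool => M.endAt p.1 p.2 = none).card

/-- The number of semiedges of `M` whose edge is coloured `c`. -/
def semiendColourCount (φ : M.E → Klein) (c : Klein) : ℕ :=
  (Finset.univ.filter fun p : M.E × Bool => M.endAt p.1 p.2 = none ∧ φ p.1 = c).card

/-- The sum of the colours on the semiedges of `M`. -/
def semiSum (φ : M.E → Klein) : Klein :=
  ∑ p : M.E × Bool, if M.endAt p.1 p.2 = none then φ p.1 else 0

/-- Delete a set of vertices, retaining dangling edges; edges with no end
outside `S` are discarded. -/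
noncomputable def delVerts (S : Finset M.V) : Multipole := by
  classical
  exact
    { V := {x : M.V // x ∉ S}
      E := {e : M.E // ∃ (b : Bool) (x : M.V), M.endAt e b = some x ∧ x ∉ S}
      fst := fun e => match M.fst e.1 with
        | none => none
        | some x => if h : x ∈ S then none else some ⟨x, h⟩
      snd := fun e => match M.snd e.1 with
        | none => none
        | some x => if h : x ∈ S then none else some ⟨x, h⟩ }

/-- The flow through the connector of `M.delVerts S` consisting of the
semiedges formerly incident with the deleted vertex `u`. -/
noncomputable def connFlow (S : Finset M.V) (φ : (M.delVerts S).E → Klein) (u : M.V) : Klein :=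
  ∑ e : (M.delVerts S).E,
    ((if M.fst e.1 = some u then φ e else 0) + (if M.snd e.1 = some u then φ e else 0))

/-- Delete a single edge (keeping its end vertices). -/
def delEdge (e0 : M.E) : Multipole where
  V := M.V
  E := {e : M.E // e ≠ e0}
  fst := fun e => M.fst e.1
  snd := fun e => M.snd e.1

/-- Delete a pair of edges (keeping their end vertices). -/
def delPair (e1 e2 : M.E) : Multipole where
  V := M.V
  E := {e : M.E // e ≠ e1 ∧ e ≠ e2}
  fst := fun e => M.fst e.1
  snd := fun e => M.snd e.1

/-- Sever the edge `e0`: replace it by two dangling edges. -/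
def sever (e0 : M.E) : Multipole where
  V := M.V
  E := M.E ⊕ Unit
  fst := fun e => match e with
    | .inl f => M.fst f
    | .inr _ => M.snd e0
  snd := fun e => match e with
    | .inl f => if f = e0 then none else M.snd f
    | .inr _ => none

/-- The I-extension `G(e₁,e₂)`: subdivide `e₁` and `e₂` each with a new vertex
and join the two new vertices by a new edge. -/
def extend (e1 e2 : M.E) : Multipole where
  V := M.V ⊕ Fin 2
  E := M.E ⊕ Fin 3
  fst := fun e => match e with
    | .inl f => (M.fst f).map Sum.inl
    | .inr i => if i = 0 then some (Sum.inr 0)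
        else if i = 1 then some (Sum.inr 1) else some (Sum.inr 0)
  snd := fun e => match e with
    | .inl f => if f = e1 then some (Sum.inr 0)
        else if f = e2 then some (Sum.inr 1) else (M.snd f).map Sum.inl
    | .inr i => if i = 0 then (M.snd e1).map Sum.inl
        else if i = 1 then (M.snd e2).map Sum.inl else some (Sum.inr 1)

/-- A bicritical snark: a snark in which the removal of any two distinct
vertices leaves a 3-edge-colourable multipole. -/
def Bicritical : Prop :=
  M.IsSnark ∧ ∀ x y : M.V, x ≠ y → (M.delVerts {x, y}).Colourable

end Multipole

/-- The data of a snark of the form `NNN(N₁,N₂,N₃)`: three negators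
`Nᵢ = Neg(Gᵢ; uᵢ, vᵢ)`, each obtained from a snark `Gᵢ` by removing a path
`uᵢ-wᵢ-vᵢ` of length two, arranged along a circle (the output connector of
`Nᵢ` joined to the input connector of `N_{i+1}`) with an additional central
vertex attached to the three residual semiedges.  The fields record, for each
`i`: the path (`eUW i`, `eWV i`), the two remaining edges at `uᵢ` (`aE i k`,
leading to the surviving vertices `aOut i k`), the two remaining edges at `vᵢ`
(`bE i k`, to `bOut i k`), and the remaining edge at `wᵢ` (`rE i`, to
`rOut i`). -/
structure NNNData where
  G : Fin 3 → Multipole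
  hSnark : ∀ i, (G i).IsSnark
  u : ∀ i : Fin 3, (G i).V
  w : ∀ i : Fin 3, (G i).V
  v : ∀ i : Fin 3, (G i).V
  huw : ∀ i, u i ≠ w i
  hwv : ∀ i, w i ≠ v i
  huv : ∀ i, u i ≠ v i
  eUW : ∀ i : Fin 3, (G i).E
  eWV : ∀ i : Fin 3, (G i).E
  hUW : ∀ i, (G i).Joins (eUW i) (u i) (w i)
  hWV : ∀ i, (G i).Joins (eWV i) (w i) (v i)
  aE : ∀ i : Fin 3, Fin 2 → (G i).E
  aOut : ∀ i : Fin 3, Fin 2 → (G i).V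
  hA : ∀ i k, (G i).Joins (aE i k) (u i) (aOut i k)
  hAout : ∀ i k, aOut i k ≠ u i ∧ aOut i k ≠ w i ∧ aOut i k ≠ v i
  bE : ∀ i : Fin 3, Fin 2 → (G i).E
  bOut : ∀ i : Fin 3, Fin 2 → (G i).V
  hB : ∀ i k, (G i).Joins (bE i k) (v i) (bOut i k)
  hBout : ∀ i k, bOut i k ≠ u i ∧ bOut i k ≠ w i ∧ bOut i k ≠ v i
  rE : ∀ i : Fin 3, (G i).E
  rOut : ∀ i : Fin 3, (G i).V
  hR : ∀ i, (G i).Joins (rE i) (w i) (rOut i)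
  hRout : ∀ i, rOut i ≠ u i ∧ rOut i ≠ w i ∧ rOut i ≠ v i
  hDistinct : ∀ i, List.Pairwise (· ≠ ·)
    [eUW i, eWV i, aE i 0, aE i 1, bE i 0, bE i 1, rE i]
  hUfull : ∀ i (e : (G i).E) (b : Bool), (G i).endAt e b = some (u i) →
    e = eUW i ∨ e = aE i 0 ∨ e = aE i 1
  hWfull : ∀ i (e : (G i).E) (b : Bool), (G i).endAt e b = some (w i) →
    e = eUW i ∨ e = eWV i ∨ e = rE i
  hVfull : ∀ i (e : (G i).E) (b : Bool), (G i).endAt e b = some (v i) →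
    e = eWV i ∨ e = bE i 0 ∨ e = bE i 1

namespace NNNData

/-- The vertices removed from `Gᵢ` to form the negator `Nᵢ`. -/
def delSet (D : NNNData) (i : Fin 3) : Finset (D.G i).V := {D.u i, D.w i, D.v i}

/-- The cubic graph `NNN(N₁,N₂,N₃)`: the disjoint union of the three negators
`Nᵢ = Gᵢ − {uᵢ,wᵢ,vᵢ}` together with the junction edges — for each `i` the
two edges joining the output connector of `Nᵢ` (dangling at `bOut i k`) to the
input connector of `N_{i+1}` (dangling at `aOut (i+1) k`), and the spoke edge
joining the residual semiedge of `Nᵢ` (dangling at `rOut i`) to the additional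
central vertex. -/
noncomputable def graph (D : NNNData) : Multipole := by
  classical
  exact
    { V := (Σ i : Fin 3, {x : (D.G i).V // x ∉ D.delSet i}) ⊕ Unit
      E := (Σ i : Fin 3, {e : (D.G i).E //
              e ≠ D.eUW i ∧ e ≠ D.eWV i ∧ e ≠ D.aE i 0 ∧ e ≠ D.aE i 1 ∧
              e ≠ D.bE i 0 ∧ e ≠ D.bE i 1 ∧ e ≠ D.rE i}) ⊕ ((Fin 3 × Fin 2) ⊕ Fin 3)
      fst := fun e => match e with
        | .inl ⟨i, e'⟩ => (match (D.G i).fst e'.1 with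
            | none => none
            | some x => if h : x ∈ D.delSet i then none else some (.inl ⟨i, x, h⟩))
        | .inr (.inl (i, k)) =>
            if h : D.bOut i k ∈ D.delSet i then none
            else some (.inl ⟨i, D.bOut i k, h⟩)
        | .inr (.inr i) =>
            if h : D.rOut i ∈ D.delSet i then none
            else some (.inl ⟨i, D.rOut i, h⟩)
      snd := fun e => match e with
        | .inl ⟨i, e'⟩ => (match (D.G i).snd e'.1 with
            | none => none
            | some x => if h : x ∈ D.delSet i then none else some (.inl ⟨i, x, h⟩))
        | .inr (.inl (i, k)) =>
            if h : D.aOut (i + 1) k ∈ D.delSet (i + 1) then none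
            else some (.inl ⟨i + 1, D.aOut (i + 1) k, h⟩)
        | .inr (.inr _) => some (.inr ()) }

end NNNData

namespace Klein

theorem sum_eq_zero_of_distinct {a b c : Klein} (ha : a ≠ 0) (hb : b ≠ 0) (hc : c ≠ 0)
    (hab : a ≠ b) (hac : a ≠ c) (hbc : b ≠ c) : a + b + c = 0 := by
  revert a b c; decide

theorem distinct_of_sum_eq_zero {a b c : Klein} (ha : a ≠ 0) (hb : b ≠ 0) (hc : c ≠ 0)
    (h : a + b + c = 0) : a ≠ b ∧ a ≠ c ∧ b ≠ c := by
  revert a b c; decide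

theorem add_self (a : Klein) : a + a = 0 := by
  revert a; decide

end Klein

namespace Multipole

variable {M : Multipole}

/-- The edge ends at `v` receive nonzero, pairwise distinct colours. -/
def ProperAt (φ : M.E → Klein) (v : M.V) : Prop :=
  (∀ p : M.E × Bool, M.endAt p.1 p.2 = some v → φ p.1 ≠ 0) ∧
  ∀ p q : M.E × Bool, M.endAt p.1 p.2 = some v → M.endAt q.1 q.2 = some v → p ≠ q →
    φ p.1 ≠ φ q.1

theorem Joins.exists_endAt_left {e : M.E} {x y : M.V} (h : M.Joins e x y) :
    ∃ b, M.endAt e b = some x := by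
  rcases h with h | h
  · exact ⟨true, by simpa [endAt] using h.1⟩
  · exact ⟨false, by simpa [endAt] using h.2⟩

theorem Joins.symm {e : M.E} {x y : M.V} (h : M.Joins e x y) : M.Joins e y x :=
  Or.symm h

/-- An end of an edge joining `x` and `y` is at `x` or `y`. -/
theorem Joins.eq_or_eq {e : M.E} {x y z : M.V} (h : M.Joins e x y) {b : Bool}
    (hz : M.endAt e b = some z) : z = x ∨ z = y := by
  rcases h with ⟨h1, h2⟩ | ⟨h1, h2⟩ <;> cases b <;> simp_all [endAt]

theorem Closed.colourable (hM : M.Closed) {φ : M.E → Klein} (h : ∀ v, ProperAt φ v) :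
    M.Colourable := by
  refine ⟨φ, fun e => ?_, fun v => (h v).2⟩
  obtain ⟨x, hx⟩ := Option.ne_none_iff_exists'.1 (hM e true)
  exact (h x).1 (e, true) hx

theorem endAt_delVerts {S : Finset M.V} (e : (M.delVerts S).E) (b : Bool) (v : M.V) (hv : v ∉ S) :
    (M.delVerts S).endAt e b = some ⟨v, hv⟩ ↔ M.endAt e.1 b = some v := by
  cases b
  · simp only [endAt, delVerts, Bool.false_eq_true, if_false]
    cases h : M.snd e.1 with
    | none => simp
    | some x => by_cases hx : x ∈ S <;> simp [hx]; rintro rfl; exact hv hx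
  · simp only [endAt, delVerts, if_true]
    cases h : M.fst e.1 with
    | none => simp
    | some x => by_cases hx : x ∈ S <;> simp [hx]; rintro rfl; exact hv hx

theorem exists_properAt_of_colourable_delVerts {S : Finset M.V}
    (h : (M.delVerts S).Colourable) : ∃ φ : M.E → Klein, ∀ v ∉ S, ProperAt φ v := by
  classical
  obtain ⟨φ, h0, h1⟩ := h
  refine ⟨fun e => if he : ∃ (b : Bool) (x : M.V), M.endAt e b = some x ∧ x ∉ S
    then φ ⟨e, he⟩ else 0, fun v hv => ⟨?_, ?_⟩⟩
  · rintro ⟨e, b⟩ hp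
    have he : ∃ (b : Bool) (x : M.V), M.endAt e b = some x ∧ x ∉ S := ⟨b, v, hp, hv⟩
    simp only [dif_pos he]
    exact h0 _
  · rintro ⟨e, b⟩ ⟨f, c⟩ hp hq hpq
    have he : ∃ (b : Bool) (x : M.V), M.endAt e b = some x ∧ x ∉ S := ⟨b, v, hp, hv⟩
    have hf : ∃ (b : Bool) (x : M.V), M.endAt f b = some x ∧ x ∉ S := ⟨c, v, hq, hv⟩
    simp only [dif_pos he, dif_pos hf]
    refine h1 ⟨v, hv⟩ (⟨e, he⟩, b) (⟨f, hf⟩, c) ((endAt_delVerts _ _ _ hv).2 hp)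
      ((endAt_delVerts _ _ _ hv).2 hq) fun h => hpq ?_
    have hinj := Prod.mk.inj h
    exact Prod.ext (congrArg Subtype.val hinj.1) hinj.2

theorem colourable_delVerts {S : Finset M.V} {φ : M.E → Klein}
    (h : ∀ v ∉ S, ProperAt φ v) : (M.delVerts S).Colourable := by
  refine ⟨fun e => φ e.1, fun ⟨e, b, x, hx, hxS⟩ => (h x hxS).1 (e, b) hx, ?_⟩
  rintro ⟨v, hv⟩ ⟨e, b⟩ ⟨f, c⟩ hp hq hpq
  refine (h v hv).2 (e.1, b) (f.1, c) ((endAt_delVerts _ _ _ hv).1 hp)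
    ((endAt_delVerts _ _ _ hv).1 hq) fun h => hpq ?_
  have hinj := Prod.mk.inj h
  exact Prod.ext (Subtype.ext hinj.1) hinj.2

/-- The sum of the colours on the edge ends at `v`. -/
def outflow (φ : M.E → Klein) (v : M.V) : Klein :=
  ∑ p : M.E × Bool with M.endAt p.1 p.2 = some v, φ p.1

theorem ProperAt.outflow_eq_zero {φ : M.E → Klein} {v : M.V} (h : ProperAt φ v)
    (hv : M.degree v = 3) : outflow φ v = 0 := by
  obtain ⟨p, q, r, hpq, hpr, hqr, hs⟩ := Finset.card_eq_three.1 hv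
  have key : ∀ s ∈ ({p, q, r} : Finset (M.E × Bool)), M.endAt s.1 s.2 = some v := fun s hs' => by
    rw [← hs] at hs'; simpa using hs'
  have hp := key p (by simp)
  have hq := key q (by simp)
  have hr := key r (by simp)
  rw [outflow, hs, Finset.sum_insert (by simp [hpq, hpr]), Finset.sum_pair hqr, ← add_assoc]
  exact Klein.sum_eq_zero_of_distinct (h.1 p hp) (h.1 q hq) (h.1 r hr) (h.2 p q hp hq hpq)
    (h.2 p r hp hr hpr) (h.2 q r hq hr hqr)

theorem Closed.sum_outflow (hM : M.Closed) (φ : M.E → Klein) : ∑ v, outflow φ v = 0 := by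
  have h : ∀ p : M.E × Bool,
      (∑ v, if M.endAt p.1 p.2 = some v then φ p.1 else 0) = φ p.1 := fun p => by
    obtain ⟨x, hx⟩ := Option.ne_none_iff_exists'.1 (hM p.1 p.2)
    simp [hx]
  simp only [outflow, Finset.sum_filter]
  rw [Finset.sum_comm]
  simp only [h, Fintype.sum_prod_type, Fintype.sum_bool, Klein.add_self, Finset.sum_const_zero]

/-- Three distinct edges at a vertex of degree three account for all its edge ends. -/
theorem ends_eq_of_joins {v x y z : M.V} (hv : M.degree v = 3) {e f g : M.E}
    (he : M.Joins e v x) (hf : M.Joins f v y) (hg : M.Joins g v z)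
    (hef : e ≠ f) (heg : e ≠ g) (hfg : f ≠ g) :
    ∃ a b c : Bool, (Finset.univ.filter fun p : M.E × Bool => M.endAt p.1 p.2 = some v) =
      {(e, a), (f, b), (g, c)} := by
  obtain ⟨a, ha⟩ := he.exists_endAt_left
  obtain ⟨b, hb⟩ := hf.exists_endAt_left
  obtain ⟨c, hc⟩ := hg.exists_endAt_left
  refine ⟨a, b, c, (Finset.eq_of_subset_of_card_le ?_ ?_).symm⟩
  · intro p hp
    simp only [Finset.mem_insert, Finset.mem_singleton] at hp
    rcases hp with rfl | rfl | rfl <;> simpa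
  · refine hv.le.trans (Finset.card_eq_three.2 ⟨_, _, _, ?_, ?_, ?_, rfl⟩).ge <;> simp [*]

theorem outflow_eq_of_joins {v x y z : M.V} (hv : M.degree v = 3) {e f g : M.E}
    (he : M.Joins e v x) (hf : M.Joins f v y) (hg : M.Joins g v z)
    (hef : e ≠ f) (heg : e ≠ g) (hfg : f ≠ g) (φ : M.E → Klein) :
    outflow φ v = φ e + φ f + φ g := by
  obtain ⟨a, b, c, h⟩ := ends_eq_of_joins hv he hf hg hef heg hfg
  rw [outflow, h, Finset.sum_insert (by simp [hef, heg]), Finset.sum_pair (by simp [hfg]),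
    ← add_assoc]

theorem properAt_of_joins {v x y z : M.V} (hv : M.degree v = 3) {e f g : M.E}
    (he : M.Joins e v x) (hf : M.Joins f v y) (hg : M.Joins g v z)
    (hef : e ≠ f) (heg : e ≠ g) (hfg : f ≠ g) {φ : M.E → Klein}
    (h0e : φ e ≠ 0) (h0f : φ f ≠ 0) (h0g : φ g ≠ 0) (hsum : φ e + φ f + φ g = 0) :
    ProperAt φ v := by
  obtain ⟨a, b, c, h⟩ := ends_eq_of_joins hv he hf hg hef heg hfg
  have key : ∀ p : M.E × Bool, M.endAt p.1 p.2 = some v →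
      p = (e, a) ∨ p = (f, b) ∨ p = (g, c) := fun p hp => by
    have : p ∈ ({(e, a), (f, b), (g, c)} : Finset (M.E × Bool)) := by rw [← h]; simpa
    simpa using this
  obtain ⟨h1, h2, h3⟩ := Klein.distinct_of_sum_eq_zero h0e h0f h0g hsum
  refine ⟨fun p hp => ?_, fun p q hp hq hpq => ?_⟩
  · rcases key p hp with rfl | rfl | rfl <;> assumption
  · rcases key p hp with rfl | rfl | rfl <;> rcases key q hq with rfl | rfl | rfl <;>
      first | exact absurd rfl hpq | assumption | (apply Ne.symm; assumption)

end Multipole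

namespace NNNData

open Multipole

variable (D : NNNData)

/-- A vertex of the negator `N_j`, as a vertex of `NNN(N₁,N₂,N₃)`. -/
def vtx (j : Fin 3) (z : (D.G j).V) (hz : z ∉ D.delSet j) : D.graph.V := Sum.inl ⟨j, z, hz⟩

/-- The central vertex. -/
def hub : D.graph.V := Sum.inr ()

/-- An edge of `N_j` having no free end. -/
def inner (j : Fin 3) (e : (D.G j).E)
    (he : e ≠ D.eUW j ∧ e ≠ D.eWV j ∧ e ≠ D.aE j 0 ∧ e ≠ D.aE j 1 ∧
      e ≠ D.bE j 0 ∧ e ≠ D.bE j 1 ∧ e ≠ D.rE j) : D.graph.E := Sum.inl ⟨j, e, he⟩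

/-- The `k`-th edge joining the output of `N_j` to the input of `N_{j+1}`. -/
def link (j : Fin 3) (k : Fin 2) : D.graph.E := Sum.inr (Sum.inl (j, k))

/-- The edge joining `N_j` to the central vertex. -/
def spoke (j : Fin 3) : D.graph.E := Sum.inr (Sum.inr j)

variable {D}

theorem vtx_eq_vtx {i j : Fin 3} {x hx z hz} (h : D.vtx i x hx = D.vtx j z hz) :
    (⟨i, x⟩ : Σ i, (D.G i).V) = ⟨j, z⟩ := by
  cases Sum.inl.inj h
  rfl

theorem vtx_inj {i : Fin 3} {x hx z hz} (h : D.vtx i x hx = D.vtx i z hz) : x = z := by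
  cases vtx_eq_vtx h
  rfl

theorem hub_ne_vtx {i : Fin 3} {x hx} : D.hub ≠ D.vtx i x hx := Sum.inr_ne_inl

theorem link_inj {i j : Fin 3} {k l : Fin 2} (h : D.link i k = D.link j l) :
    i = j ∧ k = l :=
  Prod.mk.inj (Sum.inl.inj (Sum.inr.inj h))

theorem spoke_inj {i j : Fin 3} (h : D.spoke i = D.spoke j) : i = j :=
  Sum.inr.inj (Sum.inr.inj h)

theorem inner_inj {j : Fin 3} {e f he hf} (h : D.inner j e he = D.inner j f hf) : e = f := by
  cases Sum.inl.inj h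
  rfl

theorem link_ne_spoke {i j : Fin 3} {k : Fin 2} : D.link i k ≠ D.spoke j :=
  fun h => Sum.inl_ne_inr (Sum.inr.inj h)

theorem link_ne_inner {i j : Fin 3} {k : Fin 2} {e he} : D.link i k ≠ D.inner j e he :=
  Sum.inr_ne_inl

theorem spoke_ne_inner {i j : Fin 3} {e he} : D.spoke i ≠ D.inner j e he :=
  Sum.inr_ne_inl

theorem add_two_add_one (j : Fin 3) : j + 2 + 1 = j := by
  revert j; decide

theorem mem_delSet {j : Fin 3} {z : (D.G j).V} :
    z ∈ D.delSet j ↔ z = D.u j ∨ z = D.w j ∨ z = D.v j := by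
  simp [delSet]

theorem aOut_notMem (j : Fin 3) (k : Fin 2) : D.aOut j k ∉ D.delSet j := by
  simpa [mem_delSet] using D.hAout j k

theorem bOut_notMem (j : Fin 3) (k : Fin 2) : D.bOut j k ∉ D.delSet j := by
  simpa [mem_delSet] using D.hBout j k

theorem rOut_notMem (j : Fin 3) : D.rOut j ∉ D.delSet j := by
  simpa [mem_delSet] using D.hRout j

theorem endAt_link_true (j : Fin 3) (k : Fin 2) :
    D.graph.endAt (D.link j k) true = some (D.vtx j (D.bOut j k) (bOut_notMem j k)) := by
  simp [endAt, graph, link, vtx, bOut_notMem j k]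

theorem endAt_link_false {i j : Fin 3} (hij : i + 1 = j) (k : Fin 2) :
    D.graph.endAt (D.link i k) false = some (D.vtx j (D.aOut j k) (aOut_notMem j k)) := by
  subst hij
  simp [endAt, graph, link, vtx, aOut_notMem (i + 1) k]

theorem endAt_spoke_true (j : Fin 3) :
    D.graph.endAt (D.spoke j) true = some (D.vtx j (D.rOut j) (rOut_notMem j)) := by
  simp [endAt, graph, spoke, vtx, rOut_notMem j]

theorem endAt_spoke_false (j : Fin 3) :
    D.graph.endAt (D.spoke j) false = some D.hub := by
  simp [endAt, graph, spoke, hub]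

theorem endAt_inner {j : Fin 3} {e : (D.G j).E} (he) {b : Bool} {z : (D.G j).V}
    (hz : z ∉ D.delSet j) (h : (D.G j).endAt e b = some z) :
    D.graph.endAt (D.inner j e he) b = some (D.vtx j z hz) := by
  cases b
  · simp only [endAt, Bool.false_eq_true, if_false] at h
    simp [endAt, graph, inner, vtx, h, hz]
  · simp only [endAt, if_true] at h
    simp [endAt, graph, inner, vtx, h, hz]

open Classical in
/-- The edge of `NNN(N₁,N₂,N₃)` arising from an edge of `G_j` not on the removed path
(the value on the two path edges is irrelevant). -/
noncomputable def host (D : NNNData) (j : Fin 3) (e : (D.G j).E) : D.graph.E :=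
  if e = D.aE j 0 then D.link (j + 2) 0
  else if e = D.aE j 1 then D.link (j + 2) 1
  else if e = D.bE j 0 then D.link j 0
  else if e = D.bE j 1 then D.link j 1
  else if he : e ≠ D.eUW j ∧ e ≠ D.eWV j ∧ e ≠ D.aE j 0 ∧ e ≠ D.aE j 1 ∧
      e ≠ D.bE j 0 ∧ e ≠ D.bE j 1 ∧ e ≠ D.rE j then D.inner j e he
  else D.spoke j

/-- The distinctness of the seven edges at the removed path, as a conjunction. -/
theorem distinct (D : NNNData) (j : Fin 3) :
    (D.eUW j ≠ D.eWV j ∧ D.eUW j ≠ D.aE j 0 ∧ D.eUW j ≠ D.aE j 1 ∧ D.eUW j ≠ D.bE j 0 ∧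
      D.eUW j ≠ D.bE j 1 ∧ D.eUW j ≠ D.rE j) ∧
    (D.eWV j ≠ D.aE j 0 ∧ D.eWV j ≠ D.aE j 1 ∧ D.eWV j ≠ D.bE j 0 ∧ D.eWV j ≠ D.bE j 1 ∧
      D.eWV j ≠ D.rE j) ∧
    (D.aE j 0 ≠ D.aE j 1 ∧ D.aE j 0 ≠ D.bE j 0 ∧ D.aE j 0 ≠ D.bE j 1 ∧ D.aE j 0 ≠ D.rE j) ∧
    (D.aE j 1 ≠ D.bE j 0 ∧ D.aE j 1 ≠ D.bE j 1 ∧ D.aE j 1 ≠ D.rE j) ∧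
    (D.bE j 0 ≠ D.bE j 1 ∧ D.bE j 0 ≠ D.rE j) ∧ D.bE j 1 ≠ D.rE j := by
  simpa using D.hDistinct j

theorem host_aE (j : Fin 3) (k : Fin 2) : D.host j (D.aE j k) = D.link (j + 2) k := by
  have := D.distinct j
  fin_cases k
  · simp [host]
  · simp [host, this.2.2.1.1.symm]

theorem host_bE (j : Fin 3) (k : Fin 2) : D.host j (D.bE j k) = D.link j k := by
  have := D.distinct j
  fin_cases k
  · simp [host, this.2.2.1.2.1.symm, this.2.2.2.1.1.symm]
  · simp [host, this.2.2.1.2.2.1.symm, this.2.2.2.1.2.1.symm, this.2.2.2.2.1.1.symm]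

theorem host_rE (j : Fin 3) : D.host j (D.rE j) = D.spoke j := by
  have := D.distinct j
  simp [host, this.2.2.1.2.2.2.symm, this.2.2.2.1.2.2.symm, this.2.2.2.2.1.2.symm,
    this.2.2.2.2.2.symm]

theorem host_inner {j : Fin 3} {e : (D.G j).E}
    (he : e ≠ D.eUW j ∧ e ≠ D.eWV j ∧ e ≠ D.aE j 0 ∧ e ≠ D.aE j 1 ∧
      e ≠ D.bE j 0 ∧ e ≠ D.bE j 1 ∧ e ≠ D.rE j) : D.host j e = D.inner j e he := by
  simp [host, he]

theorem edge_cases (j : Fin 3) (e : (D.G j).E) :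
    e = D.eUW j ∨ e = D.eWV j ∨ (∃ k, e = D.aE j k) ∨ (∃ k, e = D.bE j k) ∨ e = D.rE j ∨
      (e ≠ D.eUW j ∧ e ≠ D.eWV j ∧ e ≠ D.aE j 0 ∧ e ≠ D.aE j 1 ∧
        e ≠ D.bE j 0 ∧ e ≠ D.bE j 1 ∧ e ≠ D.rE j) := by
  simp only [Fin.exists_fin_two]
  tauto

theorem host_injective {j : Fin 3} {e f : (D.G j).E} (he : e ≠ D.eUW j) (he' : e ≠ D.eWV j)
    (hf : f ≠ D.eUW j) (hf' : f ≠ D.eWV j) (h : D.host j e = D.host j f) : e = f := by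
  have h2 : j + 2 ≠ j := (by decide : ∀ j : Fin 3, j + 2 ≠ j) j
  rcases edge_cases j e with h1 | h1 | ⟨k, rfl⟩ | ⟨k, rfl⟩ | rfl | hi
  · exact absurd h1 he
  · exact absurd h1 he'
  all_goals
    rcases edge_cases j f with h3 | h3 | ⟨l, rfl⟩ | ⟨l, rfl⟩ | rfl | hi'
    · exact absurd h3 hf
    · exact absurd h3 hf'
    all_goals
      try rw [host_inner hi] at h
      try rw [host_inner hi'] at h
      try simp only [host_aE, host_bE, host_rE] at h
      first
        | rfl
        | exact congrArg _ (link_inj h).2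
        | exact absurd (link_inj h).1 h2
        | exact absurd (link_inj h).1.symm h2
        | exact absurd h link_ne_spoke
        | exact absurd h link_ne_spoke.symm
        | exact absurd h link_ne_inner
        | exact absurd h link_ne_inner.symm
        | exact absurd h spoke_ne_inner
        | exact absurd h spoke_ne_inner.symm
        | exact inner_inj h

/-- An edge end of `G_j` at a surviving vertex gives an edge end of `NNN(N₁,N₂,N₃)` there. -/
theorem exists_endAt_host {j : Fin 3} {e : (D.G j).E} {b : Bool} {z : (D.G j).V}
    (hz : z ∉ D.delSet j) (h : (D.G j).endAt e b = some z) :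
    e ≠ D.eUW j ∧ e ≠ D.eWV j ∧
      ∃ b', D.graph.endAt (D.host j e) b' = some (D.vtx j z hz) := by
  have hz' : z ≠ D.u j ∧ z ≠ D.w j ∧ z ≠ D.v j := by simpa [mem_delSet] using hz
  have h1 : e ≠ D.eUW j := by
    rintro rfl; have := (D.hUW j).eq_or_eq h; tauto
  have h2 : e ≠ D.eWV j := by
    rintro rfl; have := (D.hWV j).eq_or_eq h; tauto
  refine ⟨h1, h2, ?_⟩
  rcases edge_cases j e with h3 | h3 | ⟨k, rfl⟩ | ⟨k, rfl⟩ | rfl | hi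
  · exact absurd h3 h1
  · exact absurd h3 h2
  · obtain rfl : z = D.aOut j k := ((D.hA j k).eq_or_eq h).resolve_left hz'.1
    exact ⟨false, by rw [host_aE]; exact endAt_link_false (add_two_add_one j) k⟩
  · obtain rfl : z = D.bOut j k := ((D.hB j k).eq_or_eq h).resolve_left hz'.2.2
    exact ⟨true, by rw [host_bE]; exact endAt_link_true j k⟩
  · obtain rfl : z = D.rOut j := ((D.hR j).eq_or_eq h).resolve_left hz'.2.1
    exact ⟨true, by rw [host_rE]; exact endAt_spoke_true j⟩
  · exact ⟨b, by rw [host_inner hi]; exact endAt_inner hi hz h⟩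

/-- A loop of `G_j` at a surviving vertex is an edge of `N_j`. -/
theorem inner_of_loop {j : Fin 3} {e : (D.G j).E} {z : (D.G j).V} (hz : z ∉ D.delSet j)
    (h : ∀ b, (D.G j).endAt e b = some z) :
    e ≠ D.eUW j ∧ e ≠ D.eWV j ∧ e ≠ D.aE j 0 ∧ e ≠ D.aE j 1 ∧
      e ≠ D.bE j 0 ∧ e ≠ D.bE j 1 ∧ e ≠ D.rE j := by
  have key : ∀ {f x y}, (D.G j).Joins f x y → x ∈ D.delSet j → e ≠ f := by
    rintro f x y hf hx rfl
    obtain ⟨b, hb⟩ := hf.exists_endAt_left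
    rw [h b] at hb
    exact hz (Option.some.inj hb ▸ hx)
  exact ⟨key (D.hUW j) (by simp [mem_delSet]), key (D.hWV j) (by simp [mem_delSet]),
    key (D.hA j 0) (by simp [mem_delSet]), key (D.hA j 1) (by simp [mem_delSet]),
    key (D.hB j 0) (by simp [mem_delSet]), key (D.hB j 1) (by simp [mem_delSet]),
    key (D.hR j) (by simp [mem_delSet])⟩

/-- The colouring of `G_j` induced by a colouring of `NNN(N₁,N₂,N₃)`: each path edge receives
the sum of the colours in the adjacent connector. -/
noncomputable def lift (D : NNNData) (ψ : D.graph.E → Klein) (j : Fin 3) (e : (D.G j).E) :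
    Klein :=
  if e = D.eUW j then ψ (D.link (j + 2) 0) + ψ (D.link (j + 2) 1)
  else if e = D.eWV j then ψ (D.link j 0) + ψ (D.link j 1)
  else ψ (D.host j e)

variable (ψ : D.graph.E → Klein) (j : Fin 3)

theorem lift_eUW : D.lift ψ j (D.eUW j) = ψ (D.link (j + 2) 0) + ψ (D.link (j + 2) 1) := by
  simp [lift]

theorem lift_eWV : D.lift ψ j (D.eWV j) = ψ (D.link j 0) + ψ (D.link j 1) := by
  simp [lift, (D.distinct j).1.1.symm]

theorem lift_aE (k : Fin 2) : D.lift ψ j (D.aE j k) = ψ (D.link (j + 2) k) := by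
  have := D.distinct j
  rw [lift, if_neg, if_neg, host_aE] <;> fin_cases k <;> simp <;> tauto

theorem lift_bE (k : Fin 2) : D.lift ψ j (D.bE j k) = ψ (D.link j k) := by
  have := D.distinct j
  rw [lift, if_neg, if_neg, host_bE] <;> fin_cases k <;> simp <;> tauto

theorem lift_rE : D.lift ψ j (D.rE j) = ψ (D.spoke j) := by
  have := D.distinct j
  rw [lift, if_neg (by tauto), if_neg (by tauto), host_rE]

variable {ψ j}

theorem properAt_lift {z : (D.G j).V} (hz : z ∉ D.delSet j)
    (h : ProperAt ψ (D.vtx j z hz)) : ProperAt (D.lift ψ j) z := by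
  refine ⟨?_, ?_⟩
  · rintro ⟨e, b⟩ hp
    obtain ⟨h1, h2, b', hb'⟩ := exists_endAt_host hz hp
    simp only [lift, if_neg h1, if_neg h2]
    exact h.1 (_, b') hb'
  · rintro ⟨e, b⟩ ⟨f, c⟩ hp hq hpq
    obtain ⟨h1, h2, b', hb'⟩ := exists_endAt_host hz hp
    obtain ⟨h3, h4, c', hc'⟩ := exists_endAt_host hz hq
    simp only [lift, if_neg h1, if_neg h2, if_neg h3, if_neg h4]
    by_cases hef : e = f
    · subst hef
      have hi := inner_of_loop (e := e) hz fun d => by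
        have hbc : b ≠ c := fun hbc => hpq (by rw [hbc])
        rcases (by cases b <;> cases c <;> cases d <;> simp_all : d = b ∨ d = c) with rfl | rfl
        exacts [hp, hq]
      rw [host_inner hi]
      exact h.2 (_, b) (_, c) (endAt_inner hi hz hp) (endAt_inner hi hz hq)
        fun hbc => hpq (by rw [(Prod.mk.inj hbc).2])
    · exact h.2 (_, b') (_, c') hb' hc' fun hh =>
        hef (host_injective h1 h2 h3 h4 (Prod.mk.inj hh).1)

/-- The induced colouring is proper along the removed path as soon as both connectors carry
a nonzero flow and Kirchhoff's law holds at the middle vertex. -/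
theorem properAt_lift_path (ha : ∀ k, ψ (D.link (j + 2) k) ≠ 0) (hb : ∀ k, ψ (D.link j k) ≠ 0)
    (hr : ψ (D.spoke j) ≠ 0) (hs : ψ (D.link (j + 2) 0) + ψ (D.link (j + 2) 1) ≠ 0)
    (ht : ψ (D.link j 0) + ψ (D.link j 1) ≠ 0)
    (hsum : ψ (D.link (j + 2) 0) + ψ (D.link (j + 2) 1) + (ψ (D.link j 0) + ψ (D.link j 1)) +
      ψ (D.spoke j) = 0) {z : (D.G j).V} (hz : z ∈ D.delSet j) : ProperAt (D.lift ψ j) z := by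
  have hd := D.distinct j
  have hdeg := (D.hSnark j).1
  rcases mem_delSet.1 hz with rfl | rfl | rfl
  · refine properAt_of_joins (hdeg _) (D.hUW j) (D.hA j 0) (D.hA j 1) (by tauto) (by tauto)
      (by tauto) ?_ ?_ ?_ ?_ <;> simp only [lift_eUW, lift_aE, ha, hs, ne_eq, not_false_eq_true]
    rw [add_assoc, Klein.add_self]
  · refine properAt_of_joins (hdeg _) (D.hUW j).symm (D.hWV j) (D.hR j) (by tauto) (by tauto)
      (by tauto) ?_ ?_ ?_ ?_ <;>
      simp only [lift_eUW, lift_eWV, lift_rE, hr, hs, ht, hsum, ne_eq, not_false_eq_true]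
  · refine properAt_of_joins (hdeg _) (D.hWV j).symm (D.hB j 0) (D.hB j 1) (by tauto) (by tauto)
      (by tauto) ?_ ?_ ?_ ?_ <;> simp only [lift_eWV, lift_bE, hb, ht, ne_eq, not_false_eq_true]
    rw [add_assoc, Klein.add_self]

/-- Kirchhoff's law for an entirely coloured negator. -/
theorem connector_sum (h : ∀ z (hz : z ∉ D.delSet j), ProperAt ψ (D.vtx j z hz)) :
    ψ (D.link (j + 2) 0) + ψ (D.link (j + 2) 1) + (ψ (D.link j 0) + ψ (D.link j 1)) +
      ψ (D.spoke j) = 0 := by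
  have hd := D.distinct j
  obtain ⟨hdeg, hcl, -, -⟩ := D.hSnark j
  have hw : outflow (D.lift ψ j) (D.w j) = 0 := by
    rw [← hcl.sum_outflow (D.lift ψ j)]
    refine (Finset.sum_eq_single (D.w j) (fun z _ hzw => ?_) (by simp)).symm
    by_cases hz : z ∈ D.delSet j
    · rcases mem_delSet.1 hz with rfl | rfl | rfl
      · rw [outflow_eq_of_joins (hdeg _) (D.hUW j) (D.hA j 0) (D.hA j 1) (by tauto) (by tauto)
          (by tauto), lift_eUW, lift_aE, lift_aE, add_assoc, Klein.add_self]
      · exact absurd rfl hzw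
      · rw [outflow_eq_of_joins (hdeg _) (D.hWV j).symm (D.hB j 0) (D.hB j 1) (by tauto)
          (by tauto) (by tauto), lift_eWV, lift_bE, lift_bE, add_assoc, Klein.add_self]
    · exact (properAt_lift hz (h z hz)).outflow_eq_zero (hdeg z)
  rwa [outflow_eq_of_joins (hdeg _) (D.hUW j).symm (D.hWV j) (D.hR j) (by tauto) (by tauto)
    (by tauto), lift_eUW, lift_eWV, lift_rE] at hw

theorem link_ne_zero (h : ∀ z (hz : z ∉ D.delSet j), ProperAt ψ (D.vtx j z hz)) (k : Fin 2) :
    ψ (D.link j k) ≠ 0 :=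
  (h _ (bOut_notMem j k)).1 (_, true) (endAt_link_true j k)

theorem link_ne_zero_of_succ {i : Fin 3} (hij : i + 1 = j)
    (h : ∀ z (hz : z ∉ D.delSet j), ProperAt ψ (D.vtx j z hz)) (k : Fin 2) :
    ψ (D.link i k) ≠ 0 :=
  (h _ (aOut_notMem j k)).1 (_, false) (endAt_link_false hij k)

theorem spoke_ne_zero (h : ProperAt ψ D.hub) (j : Fin 3) : ψ (D.spoke j) ≠ 0 :=
  h.1 (_, false) (endAt_spoke_false j)

/-- In an entirely coloured negator one of the two connectors carries zero flow. -/
theorem connector_eq_zero (h : ∀ z (hz : z ∉ D.delSet j), ProperAt ψ (D.vtx j z hz))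
    (hr : ψ (D.spoke j) ≠ 0) :
    ψ (D.link (j + 2) 0) + ψ (D.link (j + 2) 1) = 0 ∨ ψ (D.link j 0) + ψ (D.link j 1) = 0 := by
  by_contra! hst
  refine (D.hSnark j).2.2.2 ((D.hSnark j).2.1.colourable (φ := D.lift ψ j) fun z => ?_)
  by_cases hz : z ∈ D.delSet j
  · exact properAt_lift_path (link_ne_zero_of_succ (add_two_add_one j) h) (link_ne_zero h) hr
      hst.1 hst.2 (connector_sum h) hz
  · exact properAt_lift hz (h z hz)

theorem spoke_injective (h : ProperAt ψ D.hub) {i j : Fin 3} (hij : i ≠ j) :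
    ψ (D.spoke i) ≠ ψ (D.spoke j) := by
  refine h.2 (_, false) (_, false) (endAt_spoke_false i) (endAt_spoke_false j) fun hh =>
    hij (spoke_inj (Prod.mk.inj hh).1)

end NNNData

/-- Two consecutive entirely coloured negators behave like a path of length two: `a`, `b`, `c`
are the flows in the three connectors met, and `r`, `s` the colours of the residual edges. -/
theorem Klein.flow_through_two_negators {a b c r s : Klein} (hr : r ≠ 0) (hs : s ≠ 0)
    (hrs : r ≠ s) (h1 : a + b + r = 0) (h2 : b + c + s = 0) (h1' : a = 0 ∨ b = 0)
    (h2' : b = 0 ∨ c = 0) : a = r ∧ c = s := by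
  revert a b c r s; decide

/-- **Necessity of bicritical negators.**  Let `N₁, N₂, N₃` be negators
`Nᵢ = Neg(Gᵢ; uᵢ, vᵢ)` and suppose the cubic graph `G = NNN(N₁,N₂,N₃)` is a
bicritical snark.  Then each negator `Nᵢ` is bicritical: for every two
distinct vertices `x, y` of `Nᵢ`, the multipole `Gᵢ − {x,y}` is
3-edge-colourable. -/
theorem nnn_bicritical_negators (D : NNNData) (hG : D.graph.Bicritical) :
    ∀ (i : Fin 3) (x y : (D.G i).V),
      x ≠ D.u i ∧ x ≠ D.w i ∧ x ≠ D.v i →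
      y ≠ D.u i ∧ y ≠ D.w i ∧ y ≠ D.v i →
      x ≠ y → ((D.G i).delVerts {x, y}).Colourable := by
  open Multipole NNNData in
  intro i x y hx hy hxy
  have hx' : x ∉ D.delSet i := by simpa [mem_delSet] using hx
  have hy' : y ∉ D.delSet i := by simpa [mem_delSet] using hy
  obtain ⟨ψ, hψ⟩ := exists_properAt_of_colourable_delVerts
    (hG.2 (D.vtx i x hx') (D.vtx i y hy') fun h => hxy (vtx_inj h))
  have hub : ProperAt ψ D.hub := hψ _ (by simp [hub_ne_vtx])
  have hN : ∀ j ≠ i, ∀ z (hz : z ∉ D.delSet j), ProperAt ψ (D.vtx j z hz) := fun j hj z hz =>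
    hψ _ fun hmem => hj <| by
      rcases Finset.mem_insert.1 hmem with h | h
      · exact congrArg Sigma.fst (vtx_eq_vtx h)
      · exact congrArg Sigma.fst (vtx_eq_vtx (Finset.mem_singleton.1 h))
  have hNi : ∀ z (hz : z ∉ D.delSet i), z ≠ x → z ≠ y → ProperAt ψ (D.vtx i z hz) :=
    fun z hz hzx hzy => hψ _ fun hmem => by
      rcases Finset.mem_insert.1 hmem with h | h
      · exact hzx (vtx_inj h)
      · exact hzy (vtx_inj (Finset.mem_singleton.1 h))
  have hd : ∀ i : Fin 3, i + 1 ≠ i ∧ i + 2 ≠ i ∧ i + 1 ≠ i + 2 ∧ i + 1 + 2 = i ∧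
      i + 2 + 2 = i + 1 := by decide
  obtain ⟨d1, d2, d12, hi1, hi2⟩ := hd i
  have h1 := hN (i + 1) d1
  have h2 := hN (i + 2) d2
  have hr := spoke_ne_zero hub
  have e1 := connector_sum h1
  have e2 := connector_sum h2
  have z1 := connector_eq_zero h1 (hr _)
  have z2 := connector_eq_zero h2 (hr _)
  rw [hi1] at e1 z1
  rw [hi2] at e2 z2
  obtain ⟨hc1, hc2⟩ := Klein.flow_through_two_negators (hr _) (hr _)
    (spoke_injective hub d12) e1 e2 z1 z2
  refine colourable_delVerts (φ := D.lift ψ i) fun z hz => ?_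
  simp only [Finset.mem_insert, Finset.mem_singleton, not_or] at hz
  by_cases hzd : z ∈ D.delSet i
  · refine properAt_lift_path (link_ne_zero h2) (link_ne_zero_of_succ rfl h1) (hr i)
      (hc2 ▸ hr _) (hc1 ▸ hr _) ?_ hzd
    rw [hc1, hc2]
    exact Klein.sum_eq_zero_of_distinct (hr _) (hr _) (hr _) (spoke_injective hub d12.symm)
      (spoke_injective hub d2) (spoke_injective hub d1)
  · exact properAt_lift hzd (hNi z hzd hz.1 hz.2)
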